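/- arXiv:2212.00189 — 3 statements merged into one kernel-verified Lean document; each statement's English description precedes it below -/
import Mathlib

section
/- Let ε ∈ (0,1) and let β be a positive integer such that ε·β is an integer with ε·β ≥ 1. Let G = (V,E) be a finite simple graph, and consider any sequence of edge sets H₀, H₁, …, H_T ⊆ E with H₀ = ∅ such that for every i < T, either H_{i+1} = H_i ∪ {e} for some edge e ∈ E ∖ H_i that is underfull w.r.t. H_i (deg_{H_i}(e) < (1−ε)·β), or H_{i+1} = H_i ∖ {e} for some edge e ∈ H_i that is overfull w.r.t. H_i (deg_{H_i}(e) > β). Then T ≤ 3·β²·μ(G). -/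
open Finset
open scoped Classical

/-- The degree of a vertex `v` in an edge set `H`: the number of edges of `H` incident to `v`. -/
noncomputable def degV {V : Type*} (H : Finset (Sym2 V)) (v : V) : ℕ :=
  (H.filter (fun e => v ∈ e)).card

/-- The edge degree of an unordered pair `e = {u,w}` in an edge set `H`:
`deg_H(u) + deg_H(w)`. -/
noncomputable def degE {V : Type*} (H : Finset (Sym2 V)) (e : Sym2 V) : ℕ :=
  Sym2.lift ⟨fun u w => degV H u + degV H w, fun _ _ => add_comm _ _⟩ e

/-- `M` is a matching: its edges are non-loops and pairwise vertex-disjoint. -/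
def IsMatching {V : Type*} (M : Finset (Sym2 V)) : Prop :=
  (∀ e ∈ M, ¬ e.IsDiag) ∧ ∀ e ∈ M, ∀ f ∈ M, e ≠ f → ∀ v : V, v ∈ e → v ∉ f

/-- `matchNum F` = μ(F), the maximum size of a matching contained in the edge set `F`. -/
noncomputable def matchNum {V : Type*} (F : Finset (Sym2 V)) : ℕ :=
  F.powerset.sup (fun M => if IsMatching M then M.card else 0)

lemma degV_insert {V : Type*} {H : Finset (Sym2 V)} {e : Sym2 V} (he : e ∉ H) (v : V) :
    degV (insert e H) v = degV H v + if v ∈ e then 1 else 0 := by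
  unfold degV
  rw [filter_insert]
  split_ifs with h
  · rw [card_insert_of_notMem (by simp [he])]
  · rfl

/-- The sum of squared degrees grows by `2 deg(e) + 2` when a new edge `e` is inserted. -/
lemma sum_sq_degV_insert {V : Type*} {H : Finset (Sym2 V)} {e : Sym2 V} (W : Finset V)
    (he : e ∉ H) (hd : ¬ e.IsDiag) (hW : ∀ v ∈ e, v ∈ W) :
    ∑ v ∈ W, (degV (insert e H) v : ℤ) ^ 2 =
      ∑ v ∈ W, (degV H v : ℤ) ^ 2 + 2 * degE H e + 2 := by
  have hsplit : ∀ v ∈ W, (degV (insert e H) v : ℤ) ^ 2 =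
      (degV H v : ℤ) ^ 2 + if v ∈ e then (2 * (degV H v : ℤ) + 1) else 0 := by
    intro v _
    rw [degV_insert he]
    split_ifs <;> push_cast <;> ring
  rw [sum_congr rfl hsplit, sum_add_distrib, ← sum_filter]
  induction e using Sym2.ind with
  | _ u w =>
    have huw : u ≠ w := by simpa using hd
    have hf : W.filter (fun v => v ∈ s(u, w)) = {u, w} := by
      ext v
      simp only [mem_filter, mem_insert, mem_singleton, Sym2.mem_iff]
      exact ⟨fun h => h.2, fun h => ⟨hW v (by simpa using h), h⟩⟩
    rw [hf, sum_pair huw]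
    simp only [degE, Sym2.lift_mk]
    push_cast
    ring

lemma degE_insert_self {V : Type*} {H : Finset (Sym2 V)} {e : Sym2 V} (he : e ∉ H) :
    degE (insert e H) e = degE H e + 2 := by
  have h := degV_insert he
  induction e using Sym2.ind with
  | _ u w =>
    simp only [degE, Sym2.lift_mk, h, Sym2.mem_iff, true_or, or_true, if_true]
    ring

lemma exists_isMatching_card_eq_matchNum {V : Type*} (E : Finset (Sym2 V)) :
    ∃ M ⊆ E, IsMatching M ∧ M.card = matchNum E := by
  obtain ⟨M, hM, h⟩ := exists_mem_eq_sup E.powerset ⟨∅, by simp⟩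
    (fun M => if IsMatching M then M.card else 0)
  by_cases hm : IsMatching M
  · exact ⟨M, mem_powerset.1 hM, hm, by rw [matchNum, h, if_pos hm]⟩
  · exact ⟨∅, by simp, by simp [IsMatching], by rw [matchNum, h, if_neg hm, card_empty]⟩

lemma IsMatching.card_le_matchNum {V : Type*} {M E : Finset (Sym2 V)} (hM : IsMatching M)
    (h : M ⊆ E) : M.card ≤ matchNum E := by
  have := le_sup (f := fun M => if IsMatching M then M.card else 0) (mem_powerset.2 h)
  simpa only [if_pos hM, matchNum] using this

/-- The endpoints of a maximum matching form a vertex cover. -/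
lemma exists_cover_card_le {V : Type*} (E : Finset (Sym2 V)) (hE : ∀ e ∈ E, ¬ e.IsDiag) :
    ∃ C : Finset V, C.card ≤ 2 * matchNum E ∧ ∀ e ∈ E, ∃ v ∈ C, v ∈ e := by
  obtain ⟨M, hME, hM, hcard⟩ := exists_isMatching_card_eq_matchNum E
  refine ⟨M.biUnion Sym2.toFinset, ?_, ?_⟩
  · rw [← hcard, mul_comm]
    refine card_biUnion_le_card_mul _ _ _ fun e he => ?_
    rw [Sym2.card_toFinset_of_not_isDiag e (hM.1 e he)]
  · intro e he
    by_contra! hcon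
    have hfree : ∀ f ∈ M, ∀ v ∈ f, v ∉ e := fun f hf v hv =>
      hcon v (mem_biUnion.2 ⟨f, hf, Sym2.mem_toFinset.2 hv⟩)
    have heM : e ∉ M := fun h => by
      induction e using Sym2.ind with
      | _ u w => exact hfree _ h u (by simp) (by simp)
    have hins : IsMatching (insert e M) := by
      refine ⟨fun f hf => hE f (insert_subset he hME hf), ?_⟩
      intro f hf g hg hfg v hvf hvg
      rcases mem_insert.1 hf with rfl | hfM
      · rcases mem_insert.1 hg with rfl | hgM
        · exact hfg rfl
        · exact hfree g hgM v hvg hvf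
      · rcases mem_insert.1 hg with rfl | hgM
        · exact hfree f hfM v hvf hvg
        · exact hM.2 f hfM g hgM hfg v hvf hvg
    have := hins.card_le_matchNum (insert_subset he hME)
    rw [card_insert_of_notMem heM] at this
    omega

lemma card_le_sum_degV {V : Type*} {H : Finset (Sym2 V)} {C : Finset V}
    (hC : ∀ e ∈ H, ∃ v ∈ C, v ∈ e) : H.card ≤ ∑ v ∈ C, degV H v := by
  refine (card_le_card fun e he => ?_).trans
    (card_biUnion_le (s := C) (t := fun v => H.filter (fun e => v ∈ e)))
  obtain ⟨v, hv, hve⟩ := hC e he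
  exact mem_biUnion.2 ⟨v, hv, mem_filter.2 ⟨he, hve⟩⟩

/-- The potential that increases along the process, with squared degrees summed over `W`. -/
noncomputable def potential {V : Type*} (W : Finset V) (β : ℕ) (H : Finset (Sym2 V)) : ℤ :=
  (2 * β - 1) * H.card - ∑ v ∈ W, (degV H v : ℤ) ^ 2

lemma potential_insert {V : Type*} {H : Finset (Sym2 V)} {e : Sym2 V} (W : Finset V) (β : ℕ)
    (he : e ∉ H) (hd : ¬ e.IsDiag) (hW : ∀ v ∈ e, v ∈ W) :
    potential W β (insert e H) = potential W β H + (2 * β - 3 - 2 * degE H e) := by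
  unfold potential
  rw [sum_sq_degV_insert W he hd hW, card_insert_of_notMem he]
  push_cast
  ring

lemma potential_le {V : Type*} {H : Finset (Sym2 V)} {C W : Finset V} {β : ℕ} (hβ : 0 < β)
    (hCW : C ⊆ W) (hC : ∀ e ∈ H, ∃ v ∈ C, v ∈ e) :
    potential W β H ≤ C.card * (β : ℤ) ^ 2 := by
  have hcard : (H.card : ℤ) ≤ ∑ v ∈ C, (degV H v : ℤ) := by
    exact_mod_cast card_le_sum_degV hC
  have hβ' : (1 : ℤ) ≤ β := by exact_mod_cast hβ
  have hsub : ∑ v ∈ C, (degV H v : ℤ) ^ 2 ≤ ∑ v ∈ W, (degV H v : ℤ) ^ 2 :=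
    sum_le_sum_of_subset_of_nonneg hCW fun _ _ _ => sq_nonneg _
  calc potential W β H
      ≤ (2 * β - 1) * ∑ v ∈ C, (degV H v : ℤ) - ∑ v ∈ C, (degV H v : ℤ) ^ 2 :=
        sub_le_sub (mul_le_mul_of_nonneg_left hcard (by linarith)) hsub
    _ = ∑ v ∈ C, ((2 * β - 1) * (degV H v : ℤ) - (degV H v : ℤ) ^ 2) := by
        rw [sum_sub_distrib, mul_sum]
    _ ≤ ∑ _v ∈ C, (β : ℤ) ^ 2 := sum_le_sum fun v _ => by
        nlinarith [sq_nonneg ((β : ℤ) - degV H v), Int.natCast_nonneg (degV H v)]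
    _ = C.card * (β : ℤ) ^ 2 := by simp

/-- if H₀ = ∅ and each step inserts an underfull edge of E ∖ Hᵢ or deletes
an overfull edge of Hᵢ, then the process has length T ≤ 3·β²·μ(G). -/
theorem edbs_process_length (V : Type) (ε : ℝ) (β : ℕ) (hε : ε ∈ Set.Ioo (0 : ℝ) 1)
    (hβ : 0 < β) (k : ℕ) (hk : (k : ℝ) = ε * β) (hk1 : 1 ≤ k)
    (E : Finset (Sym2 V)) (hE : ∀ e ∈ E, ¬ e.IsDiag)
    (T : ℕ) (H : ℕ → Finset (Sym2 V)) (h0 : H 0 = ∅)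
    (hstep : ∀ i < T,
      (∃ e ∈ E, e ∉ H i ∧ (degE (H i) e : ℝ) < (1 - ε) * β ∧ H (i + 1) = insert e (H i)) ∨
      (∃ e ∈ H i, (β : ℝ) < (degE (H i) e : ℝ) ∧ H (i + 1) = (H i).erase e)) :
    T ≤ 3 * β ^ 2 * matchNum E := by
  obtain ⟨C, hCcard, hC⟩ := exists_cover_card_le E hE
  set W : Finset V := C ∪ E.biUnion Sym2.toFinset
  have hW : ∀ e ∈ E, ∀ v ∈ e, v ∈ W := fun e he v hv =>
    mem_union_right _ (mem_biUnion.2 ⟨e, he, Sym2.mem_toFinset.2 hv⟩)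
  have key : ∀ i ≤ T, H i ⊆ E ∧ (i : ℤ) ≤ potential W β (H i) := by
    intro i
    induction i with
    | zero => intro _; simp [h0, potential, degV]
    | succ i ih =>
      intro hi
      obtain ⟨hsub, hpot⟩ := ih (by omega)
      rcases hstep i (by omega) with ⟨e, heE, heH, hdeg, heq⟩ | ⟨e, heH, hdeg, heq⟩
      · have hlt : degE (H i) e + k < β := by
          have : (degE (H i) e : ℝ) + k < β := by rw [hk]; linarith
          exact_mod_cast this
        rw [heq, potential_insert W β heH (hE e heE) (hW e heE)]
        refine ⟨insert_subset heE hsub, ?_⟩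
        push_cast
        omega
      · have hlt : β < degE (H i) e := by exact_mod_cast hdeg
        have hne : e ∉ H (i + 1) := by simp [heq]
        have hins : H i = insert e (H (i + 1)) := by rw [heq, insert_erase heH]
        have heE := hsub heH
        have hp := potential_insert W β hne (hE e heE) (hW e heE)
        have hd := degE_insert_self hne
        rw [← hins] at hp hd
        refine ⟨heq ▸ (erase_subset _ _).trans hsub, ?_⟩
        push_cast
        omega
  obtain ⟨hsub, hT⟩ := key T le_rfl
  have hle := potential_le hβ subset_union_left (fun e he => hC e (hsub he)) |> hT.trans
  have hle' : T ≤ C.card * β ^ 2 := by exact_mod_cast hle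
  nlinarith [Nat.mul_le_mul_right (β ^ 2) hCcard, Nat.zero_le (β ^ 2 * matchNum E)]
end

section
/- Let β be a positive integer, let G = (V,E) be a finite simple graph, let H ⊆ E, and let e ∈ H be overfull w.r.t. H, i.e. deg_H(e) > β. Then Φ(H ∖ {e}) ≥ Φ(H) + 1. -/
open Finset
open scoped Classical

/-- The potential Φ(H) = Σ_v deg_H(v)·(β − 1/2) − Σ_{e∈H} deg_H(e). -/
noncomputable def pot {V : Type*} [Fintype V] (β : ℝ) (H : Finset (Sym2 V)) : ℝ :=
  (∑ v : V, (degV H v : ℝ) * (β - 1/2)) - ∑ e ∈ H, (degE H e : ℝ)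

theorem degV_erase_add {V : Type*} {H : Finset (Sym2 V)} {e : Sym2 V} (he : e ∈ H) (v : V) :
    degV (H.erase e) v + (if v ∈ e then 1 else 0) = degV H v := by
  unfold degV
  rw [Finset.filter_erase]
  split_ifs with hv
  · exact Finset.card_erase_add_one (Finset.mem_filter.mpr ⟨he, hv⟩)
  · rw [Finset.erase_eq_of_notMem (by simp [hv]), add_zero]

theorem sum_ite_mem_mk {V M : Type*} [Fintype V] [AddCommMonoid M] {a b : V} (hab : a ≠ b)
    (f : V → M) : ∑ v : V, (if v ∈ s(a, b) then f v else 0) = f a + f b := by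
  have hfilter : Finset.univ.filter (fun v => v ∈ s(a, b)) = {a, b} := by
    ext v
    simp
  rw [← Finset.sum_filter, hfilter, Finset.sum_pair hab]

theorem degE_eq_sum {V : Type*} [Fintype V] (H : Finset (Sym2 V)) {e : Sym2 V}
    (he : ¬ e.IsDiag) : degE H e = ∑ v : V, if v ∈ e then degV H v else 0 := by
  induction e with
  | _ a b => exact (sum_ite_mem_mk (by simpa using he) (degV H)).symm

theorem sum_ite_mem_eq_two {V : Type*} [Fintype V] {e : Sym2 V} (he : ¬ e.IsDiag) :
    ∑ v : V, (if v ∈ e then 1 else 0 : ℕ) = 2 := by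
  induction e with
  | _ a b => exact sum_ite_mem_mk (by simpa using he) fun _ => 1

theorem sum_degE_eq_sum_sq {V : Type*} [Fintype V] {H : Finset (Sym2 V)}
    (hH : ∀ e ∈ H, ¬ e.IsDiag) : ∑ e ∈ H, degE H e = ∑ v : V, degV H v ^ 2 := by
  rw [Finset.sum_congr rfl fun e he => degE_eq_sum H (hH e he), Finset.sum_comm]
  refine Finset.sum_congr rfl fun v _ => ?_
  rw [← Finset.sum_filter, Finset.sum_const, smul_eq_mul, sq]
  rfl

theorem pot_eq_sum {V : Type*} [Fintype V] (β : ℝ) {H : Finset (Sym2 V)}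
    (hH : ∀ e ∈ H, ¬ e.IsDiag) :
    pot β H = ∑ v : V, ((degV H v : ℝ) * (β - 1/2) - (degV H v : ℝ) ^ 2) := by
  have h : ∑ e ∈ H, (degE H e : ℝ) = ∑ v : V, (degV H v : ℝ) ^ 2 := by
    exact_mod_cast sum_degE_eq_sum_sq hH
  rw [pot, h, Finset.sum_sub_distrib]

theorem pot_erase {V : Type*} [Fintype V] (β : ℝ) {H : Finset (Sym2 V)}
    (hH : ∀ e ∈ H, ¬ e.IsDiag) {e : Sym2 V} (he : e ∈ H) :
    pot β (H.erase e) = pot β H + 2 * (degE H e : ℝ) - 2 * β - 1 := by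
  have hdeg : (degE H e : ℝ) = ∑ v : V, if v ∈ e then (degV H v : ℝ) else 0 := by
    exact_mod_cast degE_eq_sum H (hH e he)
  have htwo : ∑ v : V, (if v ∈ e then 1 else 0 : ℝ) = 2 := by
    exact_mod_cast sum_ite_mem_eq_two (hH e he)
  have hsub : pot β (H.erase e) - pot β H =
      2 * (degE H e : ℝ) - (β + 1/2) * ∑ v : V, (if v ∈ e then 1 else 0 : ℝ) := by
    rw [pot_eq_sum β hH, pot_eq_sum β fun f hf => hH f (Finset.mem_of_mem_erase hf), hdeg,
      Finset.mul_sum, Finset.mul_sum, ← Finset.sum_sub_distrib, ← Finset.sum_sub_distrib]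
    refine Finset.sum_congr rfl fun v _ => ?_
    rw [← degV_erase_add he v]
    split_ifs <;> push_cast <;> ring
  rw [htwo] at hsub
  linarith

/-- deleting an overfull edge increases the potential by at least 1. -/
theorem pot_erase_overfull (V : Type) [Fintype V] (β : ℕ) (hβ : 0 < β)
    (H : Finset (Sym2 V)) (hH : ∀ e ∈ H, ¬ e.IsDiag)
    (e : Sym2 V) (heH : e ∈ H) (hover : (β : ℝ) < (degE H e : ℝ)) :
    pot (β : ℝ) H + 1 ≤ pot (β : ℝ) (H.erase e) := by
  have h : (β : ℝ) + 1 ≤ (degE H e : ℝ) := by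
    exact_mod_cast Nat.succ_le_of_lt (Nat.cast_lt.mp hover)
  rw [pot_erase _ hH heH]
  linarith
end

section
/- There exists an absolute constant C > 0 with the following property. Let ε ∈ (0, 1/50), let β ≥ C·ε^{-2}·log(1/ε), let G = (V,E) be a finite simple graph, let H ⊆ E be an EDBS of G with parameter β (deg_H(e) ≤ β for every e ∈ H), let U = {e ∈ E ∖ H : deg_H(e) < (1−ε)·β}, and let M* ⊆ E be a maximum matching of G. Then there exists a partition V = L ∪ R such that every edge of M* has one endpoint in L and one endpoint in R, and, letting Ê be the set of edges of E with one endpoint in L and one in R and Ĥ = H ∩ Ê, the following two conditions hold simultaneously: (a) deg_{Ĥ}(e) ≤ (β/2)·(1 + 4ε) for every e ∈ Ĥ, and (b) deg_{Ĥ}(e) ≥ (β/2)·(1 − 5ε) for every e ∈ Ê ∖ (Ĥ ∪ U). -/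
open Finset
open scoped Classical

section LocalLemma

variable {Ω α : Type*} [Fintype Ω]

/-- The outcomes that avoid every event `A w` with `w ∈ T`. -/
noncomputable def avoiding (A : α → Finset Ω) (T : Finset α) : Finset Ω :=
  univ.filter fun x => ∀ w ∈ T, x ∉ A w

lemma mem_avoiding {A : α → Finset Ω} {T : Finset α} {x : Ω} :
    x ∈ avoiding A T ↔ ∀ w ∈ T, x ∉ A w := by
  simp [avoiding]

lemma avoiding_anti (A : α → Finset Ω) {S T : Finset α} (h : S ⊆ T) :
    avoiding A T ⊆ avoiding A S := fun _ hx =>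
  mem_avoiding.2 fun w hw => mem_avoiding.1 hx w (h hw)

variable [DecidableEq Ω]

lemma card_avoiding_le (A : α → Finset Ω) (S T : Finset α) :
    (avoiding A T).card ≤ (avoiding A (T ∪ S)).card + ∑ w ∈ S, (A w ∩ avoiding A T).card := by
  refine (card_le_card (t := avoiding A (T ∪ S) ∪ S.biUnion fun w => A w ∩ avoiding A T) ?_).trans
    ((card_union_le _ _).trans (Nat.add_le_add_left card_biUnion_le _))
  intro x hx
  by_cases h : ∃ w ∈ S, x ∈ A w
  · obtain ⟨w, hw, hxw⟩ := h
    exact mem_union_right _ (mem_biUnion.2 ⟨w, hw, mem_inter.2 ⟨hxw, hx⟩⟩)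
  · push Not at h
    refine mem_union_left _ (mem_avoiding.2 fun w hw => ?_)
    rcases mem_union.1 hw with hw | hw
    · exact mem_avoiding.1 hx w hw
    · exact h w hw

/-- The inductive estimate behind the symmetric local lemma. -/
lemma card_inter_avoiding_le (A : α → Finset Ω) (Γ : α → Finset α) {p d : ℝ} (hp : 0 ≤ p)
    (hpd : 4 * p * d ≤ 1) (hΓ : ∀ v, ((Γ v).card : ℝ) ≤ d)
    (hA : ∀ v T, Disjoint T (Γ v) →
      ((A v ∩ avoiding A T).card : ℝ) ≤ p * (avoiding A T).card) (S : Finset α) (v : α) :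
    ((A v ∩ avoiding A S).card : ℝ) ≤ 2 * p * (avoiding A S).card := by
  induction S using Finset.strongInduction generalizing v with
  | H S ih =>
  have hT := hA v (S \ Γ v) sdiff_disjoint
  have hsub : ((A v ∩ avoiding A S).card : ℝ) ≤ (A v ∩ avoiding A (S \ Γ v)).card := by
    exact_mod_cast card_le_card (inter_subset_inter_left (avoiding_anti A sdiff_subset))
  suffices h : ((avoiding A (S \ Γ v)).card : ℝ) ≤ 2 * (avoiding A S).card by nlinarith
  rcases (S ∩ Γ v).eq_empty_or_nonempty with h0 | ⟨u, hu⟩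
  · rw [sdiff_eq_self_of_disjoint (disjoint_iff_inter_eq_empty.2 h0)]
    linarith [Nat.cast_nonneg (α := ℝ) (avoiding A S).card]
  · have hss : S \ Γ v ⊂ S := by
      refine (ssubset_iff_of_subset sdiff_subset).2 ⟨u, (mem_inter.1 hu).1, fun h => ?_⟩
      exact (mem_sdiff.1 h).2 (mem_inter.1 hu).2
    have hun := card_avoiding_le A (S ∩ Γ v) (S \ Γ v)
    rw [sdiff_union_inter] at hun
    have hun' : ((avoiding A (S \ Γ v)).card : ℝ) ≤ (avoiding A S).card +
        ∑ w ∈ S ∩ Γ v, ((A w ∩ avoiding A (S \ Γ v)).card : ℝ) := by exact_mod_cast hun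
    have hsum : ∑ w ∈ S ∩ Γ v, ((A w ∩ avoiding A (S \ Γ v)).card : ℝ) ≤
        (S ∩ Γ v).card * (2 * p * (avoiding A (S \ Γ v)).card) := by
      rw [← nsmul_eq_mul]
      exact sum_le_card_nsmul _ _ _ fun w _ => ih _ hss w
    have hcard : ((S ∩ Γ v).card : ℝ) ≤ d :=
      (Nat.cast_le.2 (card_le_card inter_subset_right)).trans (hΓ v)
    have hmul := mul_le_mul_of_nonneg_right hcard
      (by positivity : 0 ≤ 2 * p * ((avoiding A (S \ Γ v)).card : ℝ))
    have hmul' := mul_le_mul_of_nonneg_right hpd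
      (by positivity : 0 ≤ ((avoiding A (S \ Γ v)).card : ℝ))
    nlinarith

/-- The symmetric Lovász local lemma for the uniform distribution on a finite type. -/
theorem exists_forall_notMem_of_local [Nonempty Ω] [Fintype α] (A : α → Finset Ω)
    (Γ : α → Finset α) {p d : ℝ} (hp : 0 ≤ p) (hp1 : 2 * p < 1)
    (hpd : 4 * p * d ≤ 1) (hΓ : ∀ v, ((Γ v).card : ℝ) ≤ d)
    (hA : ∀ v T, Disjoint T (Γ v) →
      ((A v ∩ avoiding A T).card : ℝ) ≤ p * (avoiding A T).card) :
    ∃ x, ∀ v, x ∉ A v := by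
  have hpos : ∀ S : Finset α, (0 : ℝ) < (avoiding A S).card := by
    intro S
    induction S using Finset.induction_on with
    | empty => simp [avoiding, Fintype.card_pos]
    | insert v S _ ih =>
      have h := card_avoiding_le A {v} S
      rw [sum_singleton, union_comm, ← insert_eq] at h
      have h' : ((avoiding A S).card : ℝ) ≤
        (avoiding A (insert v S)).card + (A v ∩ avoiding A S).card := by exact_mod_cast h
      nlinarith [card_inter_avoiding_le A Γ hp hpd hΓ hA S v]
  obtain ⟨x, hx⟩ := card_pos.1 (Nat.cast_pos.1 (hpos univ))
  exact ⟨x, fun v => mem_avoiding.1 hx v (mem_univ v)⟩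

end LocalLemma

section RandomSigns

variable {ι : Type*}

/-- The sign `±1` encoded by a Boolean. -/
def boolSign (b : Bool) : ℝ := if b then 1 else -1

lemma boolSign_not (b : Bool) : boolSign (!b) = -boolSign b := by
  cases b <;> simp [boolSign]

/-- Negating the coordinate `q` of a point of the Boolean cube. -/
noncomputable def flipAt (q : ι) (x : ι → Bool) : ι → Bool := Function.update x q (!x q)

lemma flipAt_self (q : ι) (x : ι → Bool) : flipAt q x q = !x q := by simp [flipAt]

lemma flipAt_of_ne {q r : ι} (h : r ≠ q) (x : ι → Bool) : flipAt q x r = x r := by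
  simp [flipAt, h]

lemma flipAt_involutive (q : ι) : Function.Involutive (flipAt q) := by
  intro x
  ext r
  by_cases h : r = q
  · subst h; simp [flipAt_self]
  · simp [flipAt_of_ne h]

variable [Fintype ι]

lemma sum_mul_exp_boolSign (g : (ι → Bool) → ℝ) (q : ι) (hg : ∀ x, g (flipAt q x) = g x) (c : ℝ) :
    ∑ x, g x * Real.exp (c * boolSign (x q)) = Real.cosh c * ∑ x, g x := by
  have hflip : ∑ x, g x * Real.exp (c * boolSign (x q)) =
      ∑ x, g x * Real.exp (-(c * boolSign (x q))) := by
    rw [← Equiv.sum_comp (flipAt_involutive q).toPerm]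
    simp [hg, flipAt_self, boolSign_not]
  have hcosh : ∀ b, Real.exp (c * boolSign b) + Real.exp (-(c * boolSign b)) =
      2 * Real.cosh c := by
    intro b
    cases b <;> simp [boolSign, Real.cosh_eq] <;> ring
  have hadd : ∑ x, g x * Real.exp (c * boolSign (x q)) +
      ∑ x, g x * Real.exp (-(c * boolSign (x q))) = 2 * (Real.cosh c * ∑ x, g x) := by
    rw [← sum_add_distrib, mul_sum, mul_sum]
    refine sum_congr rfl fun x _ => ?_
    rw [← mul_add, hcosh]; ring
  linarith

lemma sum_mul_exp_sum_boolSign (c : ι → ℝ) (Q : Finset ι) (g : (ι → Bool) → ℝ)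
    (hg : ∀ q ∈ Q, ∀ x, g (flipAt q x) = g x) :
    ∑ x, g x * Real.exp (∑ q ∈ Q, c q * boolSign (x q)) =
      (∏ q ∈ Q, Real.cosh (c q)) * ∑ x, g x := by
  induction Q using Finset.induction_on generalizing g with
  | empty => simp
  | insert q Q hq ih =>
    have h := ih (fun x => g x * Real.exp (c q * boolSign (x q))) fun r hr x => by
      rw [hg r (mem_insert_of_mem hr), flipAt_of_ne (by rintro rfl; exact hq hr)]
    rw [sum_mul_exp_boolSign g q (hg q (mem_insert_self _ _))] at h
    rw [prod_insert hq, mul_comm (Real.cosh (c q)), mul_assoc, ← h]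
    refine sum_congr rfl fun x _ => ?_
    rw [sum_insert hq, Real.exp_add, mul_assoc]

lemma sum_exp_signed_sum_le (a : ι → ℝ) {K : ℝ} (hK : ∑ q, a q ^ 2 ≤ K) (B : Finset (ι → Bool))
    (hB : ∀ q, a q ≠ 0 → ∀ x, flipAt q x ∈ B ↔ x ∈ B) (t : ℝ) :
    ∑ x ∈ B, Real.exp (t * ∑ q, a q * boolSign (x q)) ≤ Real.exp (t ^ 2 * K / 2) * B.card := by
  have h := sum_mul_exp_sum_boolSign (fun q => t * a q) (univ.filter fun q => a q ≠ 0)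
    (fun x => if x ∈ B then (1 : ℝ) else 0) fun q hq x => by simp [hB q (mem_filter.1 hq).2]
  have hexp : ∀ x : ι → Bool, ∑ q ∈ univ.filter (fun q => a q ≠ 0), t * a q * boolSign (x q) =
      t * ∑ q, a q * boolSign (x q) := by
    intro x
    rw [mul_sum, sum_filter]
    refine sum_congr rfl fun q _ => ?_
    by_cases hq : a q = 0
    · simp [hq]
    · simp [hq, mul_assoc]
  simp only [hexp, ite_mul, one_mul, zero_mul, sum_ite_mem, univ_inter, sum_const, nsmul_eq_mul,
    mul_one] at h
  rw [h]
  refine mul_le_mul_of_nonneg_right ?_ (Nat.cast_nonneg _)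
  calc ∏ q ∈ univ.filter (fun q => a q ≠ 0), Real.cosh (t * a q)
      ≤ ∏ q ∈ univ.filter (fun q => a q ≠ 0), Real.exp ((t * a q) ^ 2 / 2) :=
        prod_le_prod (fun _ _ => (Real.cosh_pos _).le) fun _ _ => Real.cosh_le_exp_half_sq _
    _ = Real.exp (∑ q ∈ univ.filter (fun q => a q ≠ 0), (t * a q) ^ 2 / 2) :=
        (Real.exp_sum _ _).symm
    _ ≤ Real.exp (∑ q, (t * a q) ^ 2 / 2) := by
        refine Real.exp_le_exp.2 (sum_le_sum_of_subset_of_nonneg (filter_subset _ _) ?_)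
        intros; positivity
    _ ≤ Real.exp (t ^ 2 * K / 2) := by
        refine Real.exp_le_exp.2 ?_
        have : ∑ q, (t * a q) ^ 2 / 2 = t ^ 2 / 2 * ∑ q, a q ^ 2 := by
          rw [mul_sum]; exact sum_congr rfl fun _ _ => by ring
        rw [this]
        nlinarith [mul_le_mul_of_nonneg_left hK (by positivity : 0 ≤ t ^ 2 / 2)]

/-- A Hoeffding bound for signed sums, conditional on a set of outcomes that does not depend on
the signs involved. -/
lemma card_filter_signed_sum_le (a : ι → ℝ) {K l : ℝ} (hK0 : 0 < K) (hl : 0 ≤ l)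
    (hK : ∑ q, a q ^ 2 ≤ K) (B : Finset (ι → Bool))
    (hB : ∀ q, a q ≠ 0 → ∀ x, flipAt q x ∈ B ↔ x ∈ B) :
    (((univ.filter fun x => l < |∑ q, a q * boolSign (x q)|) ∩ B).card : ℝ) ≤
      2 * Real.exp (-(l ^ 2 / (2 * K))) * B.card := by
  set t : ℝ := l / K with ht
  have ht0 : 0 ≤ t := div_nonneg hl hK0.le
  have h1 := sum_exp_signed_sum_le a hK B hB t
  have h2 := sum_exp_signed_sum_le a hK B hB (-t)
  have h3 : (((univ.filter fun x => l < |∑ q, a q * boolSign (x q)|) ∩ B).card : ℝ) *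
      Real.exp (t * l) ≤ ∑ x ∈ B, (Real.exp (t * ∑ q, a q * boolSign (x q)) +
        Real.exp (-t * ∑ q, a q * boolSign (x q))) := by
    rw [← nsmul_eq_mul, ← sum_const]
    refine (sum_le_sum fun x hx => ?_).trans
      (sum_le_sum_of_subset_of_nonneg inter_subset_right fun _ _ _ => by positivity)
    have hx' : l < |∑ q, a q * boolSign (x q)| := (mem_filter.1 (mem_inter.1 hx).1).2
    rcases lt_abs.1 hx' with h | h
    · have := Real.exp_le_exp.2 (mul_le_mul_of_nonneg_left h.le ht0)
      have := Real.exp_pos (-t * ∑ q, a q * boolSign (x q))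
      linarith
    · have := Real.exp_le_exp.2 (mul_le_mul_of_nonneg_left h.le ht0)
      have := Real.exp_pos (t * ∑ q, a q * boolSign (x q))
      rw [mul_neg, ← neg_mul] at *
      linarith
  rw [sum_add_distrib] at h3
  rw [neg_sq] at h2
  have h4 : Real.exp (t ^ 2 * K / 2) = Real.exp (-(l ^ 2 / (2 * K))) * Real.exp (t * l) := by
    rw [← Real.exp_add, ht]
    congr 1
    field_simp
    ring
  rw [h4] at h1 h2
  refine le_of_mul_le_mul_right ?_ (Real.exp_pos (t * l))
  linarith

/-- Small discrepancy of a sparse matrix, via the local lemma. -/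
theorem exists_signs_of_sparse {α : Type*} [Fintype α] (a : α → ι → ℝ) {K l d : ℝ} (hK0 : 0 < K)
    (hl : 0 ≤ l) (hK : ∀ v, ∑ q, a v q ^ 2 ≤ K) (hd : 1 ≤ d)
    (hΓ : ∀ v, ((univ.filter fun w => ∃ q, a v q ≠ 0 ∧ a w q ≠ 0).card : ℝ) ≤ d)
    (hnum : 8 * d * Real.exp (-(l ^ 2 / (2 * K))) ≤ 1) :
    ∃ x : ι → Bool, ∀ v, |∑ q, a v q * boolSign (x q)| ≤ l := by
  have he := Real.exp_pos (-(l ^ 2 / (2 * K)))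
  obtain ⟨x, hx⟩ := exists_forall_notMem_of_local
    (fun v => univ.filter fun x : ι → Bool => l < |∑ q, a v q * boolSign (x q)|)
    (fun v => univ.filter fun w => ∃ q, a v q ≠ 0 ∧ a w q ≠ 0)
    (p := 2 * Real.exp (-(l ^ 2 / (2 * K)))) (d := d) (by positivity) (by nlinarith)
    (by linarith) hΓ (fun v T hT => by
      refine card_filter_signed_sum_le (a v) hK0 hl (hK v) _ fun q hq x => ?_
      have hsum : ∀ w ∈ T, ∑ r, a w r * boolSign (flipAt q x r) =
          ∑ r, a w r * boolSign (x r) := by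
        intro w hw
        have hwq : a w q = 0 := by
          by_contra h
          exact disjoint_left.1 hT hw (mem_filter.2 ⟨mem_univ _, q, hq, h⟩)
        refine sum_congr rfl fun r _ => ?_
        by_cases hr : r = q
        · subst hr; simp [hwq]
        · rw [flipAt_of_ne hr]
      simp only [mem_avoiding, mem_filter, mem_univ, true_and]
      exact forall₂_congr fun w hw => by rw [hsum w hw])
  exact ⟨x, fun v => not_lt.1 fun h => hx v (mem_filter.2 ⟨mem_univ _, h⟩)⟩

end RandomSigns

lemma sixteen_mul_sq_mul_exp_le_one {ε β : ℝ} (hε : ε ∈ Set.Ioo (0 : ℝ) (1 / 50))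
    (hβ : 4000 * ε⁻¹ ^ 2 * Real.log (1 / ε) ≤ β) :
    1 ≤ β ∧ 16 * β ^ 2 * Real.exp (-(ε ^ 2 * β)) ≤ 1 := by
  obtain ⟨h0, h1⟩ := hε
  have hlog : 1 ≤ Real.log (1 / ε) := by
    rw [Real.le_log_iff_exp_le (by positivity)]
    have : (50 : ℝ) ≤ 1 / ε := by rw [le_div_iff₀ h0]; linarith
    linarith [Real.exp_one_lt_d9]
  set y := ε ^ 2 * β with hy
  have hyl : 4000 * Real.log (1 / ε) ≤ y := by
    have := mul_le_mul_of_nonneg_left hβ (sq_nonneg ε)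
    have h : ε ^ 2 * (4000 * ε⁻¹ ^ 2 * Real.log (1 / ε)) = 4000 * Real.log (1 / ε) := by
      field_simp
    linarith
  have hβy : β = y * (1 / ε) ^ 2 := by rw [hy]; field_simp
  have hinv : 1 / ε = Real.exp (Real.log (1 / ε)) := (Real.exp_log (by positivity)).symm
  have hy0 : 4000 ≤ y := by linarith
  have hinv1 : 1 ≤ 1 / ε := by rw [le_div_iff₀ h0]; linarith
  refine ⟨by rw [hβy]; nlinarith [one_le_pow₀ hinv1 (n := 2)], ?_⟩
  have h4 : (1 / ε) ^ 4 ≤ Real.exp (y / 2) := by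
    rw [hinv, ← Real.exp_nat_mul]
    refine Real.exp_le_exp.2 ?_
    push_cast
    linarith
  have h5 : 16 * y ^ 2 ≤ Real.exp (y / 2) := by
    have h6 : y / 6 ≤ Real.exp (y / 6) := by linarith [Real.add_one_le_exp (y / 6)]
    have h7 := pow_le_pow_left₀ (by positivity) h6 3
    rw [← Real.exp_nat_mul] at h7
    have h8 : ((3 : ℕ) : ℝ) * (y / 6) = y / 2 := by push_cast; ring
    rw [h8] at h7
    nlinarith [sq_nonneg y]
  have h9 : 16 * β ^ 2 ≤ Real.exp y := by
    calc 16 * β ^ 2 = (16 * y ^ 2) * (1 / ε) ^ 4 := by rw [hβy]; ring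
      _ ≤ Real.exp (y / 2) * Real.exp (y / 2) := by gcongr
      _ = Real.exp y := by rw [← Real.exp_add]; ring_nf
  calc 16 * β ^ 2 * Real.exp (-y) ≤ Real.exp y * Real.exp (-y) := by gcongr
    _ = 1 := by rw [← Real.exp_add]; simp

section Bipartition

variable {V : Type*}

/-- The pairs of a matching, completed by loops at unmatched vertices, with opposite signs at the
two ends of each matching edge. -/
lemma IsMatching.exists_pairing {M : Finset (Sym2 V)} (hM : IsMatching M) :
    ∃ (P : V → Sym2 V) (s : V → Bool), (∀ v, v ∈ P v) ∧
      ∀ u w, s(u, w) ∈ M → P u = P w ∧ s u ≠ s w := by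
  let P : V → Sym2 V := fun v => if h : ∃ e ∈ M, v ∈ e then h.choose else s(v, v)
  have hPM : ∀ e ∈ M, ∀ v ∈ e, P v = e := by
    intro e he v hv
    have h : ∃ e ∈ M, v ∈ e := ⟨e, he, hv⟩
    have hPv : P v = h.choose := dif_pos h
    rw [hPv]
    by_contra hne
    exact hM.2 _ h.choose_spec.1 _ he hne v h.choose_spec.2 hv
  refine ⟨P, fun v => decide (v = (P v).out.1), fun v => ?_, fun u w h => ?_⟩
  · by_cases h : ∃ e ∈ M, v ∈ e
    · rw [show P v = h.choose from dif_pos h]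
      exact h.choose_spec.2
    · simp [show P v = s(v, v) from dif_neg h]
  · have hu := hPM _ h u (Sym2.mem_mk_left _ _)
    have hw := hPM _ h w (Sym2.mem_mk_right _ _)
    have hne : u ≠ w := by simpa using hM.1 _ h
    have ho := Sym2.out_fst_mem s(u, w)
    refine ⟨hu.trans hw.symm, ?_⟩
    simp only [hu, hw, ne_eq, decide_eq_decide]
    rcases Sym2.mem_iff.1 ho with h | h <;> rw [h] <;> simp [hne, hne.symm]

lemma degV_le_of_degE_le {H : Finset (Sym2 V)} {β : ℝ} (hβ : 0 ≤ β)
    (hH : ∀ e ∈ H, (degE H e : ℝ) ≤ β) (v : V) : (degV H v : ℝ) ≤ β := by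
  rcases (H.filter fun e => v ∈ e).eq_empty_or_nonempty with h | ⟨e, he⟩
  · simpa [degV, h] using hβ
  · obtain ⟨heH, w, rfl⟩ := mem_filter.1 he
    have : ((degV H v + degV H w : ℕ) : ℝ) ≤ β := hH _ heH
    push_cast at this
    linarith [Nat.cast_nonneg (α := ℝ) (degV H w)]

variable [Fintype V]

lemma degV_eq_card_neighbors (H : Finset (Sym2 V)) (v : V) :
    degV H v = (univ.filter fun w => s(v, w) ∈ H).card := by
  symm
  refine card_bij (fun w _ => s(v, w)) (fun w hw => ?_) (fun w _ w' _ h => ?_) fun e he => ?_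
  · simpa using hw
  · exact Sym2.congr_right.1 h
  · obtain ⟨heH, w, rfl⟩ := mem_filter.1 he
    exact ⟨w, by simpa using heH, rfl⟩

/-- A symmetric relation of bounded degree on vertices, together with a grouping of the vertices
into pairs, admits signs that respect the pairing up to a prescribed relative sign and have small
sum on every neighbourhood. -/
lemma exists_signs_small_sums (N : V → Finset V) (hN : ∀ v w, w ∈ N v → v ∈ N w) {β l : ℝ}
    (hβ : 1 ≤ β) (hl : 0 ≤ l) (hdeg : ∀ v, ((N v).card : ℝ) ≤ β) (P : V → Sym2 V)
    (hP : ∀ v, v ∈ P v) (s : V → ℝ) (hs : ∀ v, |s v| ≤ 1)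
    (hnum : 16 * β ^ 2 * Real.exp (-(l ^ 2 / (4 * β))) ≤ 1) :
    ∃ x : Sym2 V → Bool, ∀ v, |∑ w ∈ N v, s w * boolSign (x (P w))| ≤ l := by
  have hfib : ∀ q, (univ.filter fun u => P u = q).card ≤ 2 := by
    intro q
    induction q with
    | _ b c =>
      refine (card_le_card (t := {b, c}) fun u hu => ?_).trans card_le_two
      have := hP u
      rw [(mem_filter.1 hu).2] at this
      simpa using this
  let a : V → Sym2 V → ℝ := fun v q => ∑ u ∈ (N v).filter (fun u => P u = q), s u
  have ha : ∀ v q, a v q ≠ 0 → ∃ u ∈ N v, P u = q := by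
    intro v q h
    obtain ⟨u, hu, -⟩ := exists_ne_zero_of_sum_ne_zero h
    exact ⟨u, (mem_filter.1 hu).1, (mem_filter.1 hu).2⟩
  have hK : ∀ v, ∑ q, a v q ^ 2 ≤ 2 * β := by
    intro v
    have hq : ∀ q, a v q ^ 2 ≤ 2 * (((N v).filter fun u => P u = q).card : ℝ) := by
      intro q
      have h1 : |a v q| ≤ (((N v).filter fun u => P u = q).card : ℝ) := by
        refine (abs_sum_le_sum_abs _ _).trans ?_
        refine (sum_le_card_nsmul _ _ 1 fun u _ => hs u).trans_eq (by simp)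
      have h2 : (((N v).filter fun u => P u = q).card : ℝ) ≤ 2 := by
        exact_mod_cast (card_le_card (filter_subset_filter _ (subset_univ _))).trans (hfib q)
      rw [← sq_abs]
      nlinarith [abs_nonneg (a v q)]
    refine (sum_le_sum fun q _ => hq q).trans ?_
    rw [← mul_sum, ← Nat.cast_sum,
      ← card_eq_sum_card_fiberwise (f := P) (t := univ) fun _ _ => mem_univ _]
    linarith [hdeg v]
  have hΓ : ∀ v, ((univ.filter fun w => ∃ q, a v q ≠ 0 ∧ a w q ≠ 0).card : ℝ) ≤ 2 * β ^ 2 := by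
    intro v
    have hnat : ∀ v, (N v).card ≤ ⌊β⌋₊ := fun v => Nat.le_floor (hdeg v)
    have hsub : (univ.filter fun w => ∃ q, a v q ≠ 0 ∧ a w q ≠ 0) ⊆
        (N v).biUnion fun u => (univ.filter fun u' => P u' = P u).biUnion N := by
      intro w hw
      obtain ⟨q, h1, h2⟩ := (mem_filter.1 hw).2
      obtain ⟨u, hu, rfl⟩ := ha _ _ h1
      obtain ⟨u', hu', h⟩ := ha _ _ h2
      exact mem_biUnion.2 ⟨u, hu, mem_biUnion.2 ⟨u', by simpa using h, hN _ _ hu'⟩⟩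
    have hcard : (univ.filter fun w => ∃ q, a v q ≠ 0 ∧ a w q ≠ 0).card ≤
        ⌊β⌋₊ * (2 * ⌊β⌋₊) :=
      (card_le_card hsub).trans <| (card_biUnion_le_card_mul _ _ _ fun u _ =>
        (card_biUnion_le_card_mul _ _ _ fun u' _ => hnat u').trans
          (Nat.mul_le_mul_right _ (hfib _))).trans (Nat.mul_le_mul_right _ (hnat v))
    have hfl := Nat.floor_le (zero_le_one.trans hβ)
    calc ((univ.filter fun w => ∃ q, a v q ≠ 0 ∧ a w q ≠ 0).card : ℝ)
        ≤ (⌊β⌋₊ : ℝ) * (2 * ⌊β⌋₊) := by exact_mod_cast hcard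
      _ ≤ 2 * β ^ 2 := by nlinarith [Nat.cast_nonneg (α := ℝ) ⌊β⌋₊]
  obtain ⟨x, hx⟩ := exists_signs_of_sparse a (K := 2 * β) (l := l) (d := 2 * β ^ 2)
    (by linarith) hl hK (by nlinarith) hΓ (by convert hnum using 1; ring_nf)
  refine ⟨x, fun v => ?_⟩
  convert hx v using 2
  rw [← sum_fiberwise (N v) P]
  refine sum_congr rfl fun q _ => ?_
  rw [sum_mul]
  exact sum_congr rfl fun u hu => by rw [(mem_filter.1 hu).2]

/-- The edges of `H` at `v` that change colour number half the degree, up to half the signed sum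
of the colours of the neighbours. -/
lemma abs_degV_bichromatic_sub (H F : Finset (Sym2 V)) (c : V → Bool)
    (hF : ∀ v w, s(v, w) ∈ F ↔ s(v, w) ∈ H ∧ c v ≠ c w) (v : V) :
    |(degV F v : ℝ) - degV H v / 2| =
      |∑ w ∈ univ.filter (fun w => s(v, w) ∈ H), boolSign (c w)| / 2 := by
  have hfilter : (univ.filter fun w => s(v, w) ∈ F) =
      (univ.filter fun w => s(v, w) ∈ H).filter fun w => c v ≠ c w := by
    ext w; simp [hF]
  have hsum : (degV F v : ℝ) - degV H v / 2 =
      -(boolSign (c v) * ∑ w ∈ univ.filter (fun w => s(v, w) ∈ H), boolSign (c w)) / 2 := by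
    rw [degV_eq_card_neighbors F, degV_eq_card_neighbors H, hfilter, card_filter, card_eq_sum_ones]
    push_cast
    rw [sum_div, ← sum_sub_distrib, mul_sum, ← sum_neg_distrib, sum_div]
    refine sum_congr rfl fun w _ => ?_
    cases c v <;> cases c w <;> simp [boolSign] <;> norm_num
  rw [hsum, abs_div, abs_neg, abs_mul]
  have : |boolSign (c v)| = 1 := by cases c v <;> simp [boolSign]
  rw [this, one_mul, abs_two]

end Bipartition

/-- there is a bipartition V = L ∪ R in which every edge of the maximum
matching M* crosses, and the induced bipartite part Ĥ of H has edge degrees between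
(β/2)(1 − 5ε) (for edges of Ê outside Ĥ ∪ U) and (β/2)(1 + 4ε) (for edges of Ĥ). -/
theorem exists_good_bipartition :
    ∃ C : ℝ, 0 < C ∧
      ∀ (V : Type) [Fintype V] (ε β : ℝ), ε ∈ Set.Ioo (0 : ℝ) (1/50) →
        C * ε⁻¹ ^ 2 * Real.log (1/ε) ≤ β →
        ∀ (E H U Mstar : Finset (Sym2 V)), (∀ e ∈ E, ¬ e.IsDiag) → H ⊆ E →
          (∀ e ∈ H, (degE H e : ℝ) ≤ β) →
          U = E.filter (fun e => e ∉ H ∧ (degE H e : ℝ) < (1 - ε) * β) →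
          Mstar ⊆ E → IsMatching Mstar → Mstar.card = matchNum E →
          ∃ L R : Finset V, L ∪ R = Finset.univ ∧ Disjoint L R ∧
            (∀ e ∈ Mstar, ∃ u ∈ L, ∃ w ∈ R, e = s(u, w)) ∧
            ∀ Ehat : Finset (Sym2 V),
              Ehat = E.filter (fun e => ∃ u ∈ L, ∃ w ∈ R, e = s(u, w)) →
              ∀ Hhat : Finset (Sym2 V), Hhat = H ∩ Ehat →
                (∀ e ∈ Hhat, (degE Hhat e : ℝ) ≤ β / 2 * (1 + 4 * ε)) ∧
                (∀ e ∈ Ehat, e ∉ Hhat ∪ U → β / 2 * (1 - 5 * ε) ≤ (degE Hhat e : ℝ)) := by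
  refine ⟨4000, by norm_num, ?_⟩
  intro V _ ε β hε hβ E H U M hE hHE hH hU hME hM _
  obtain ⟨hβ1, hnum⟩ := sixteen_mul_sq_mul_exp_le_one hε hβ
  have hβ0 : 0 < β := by linarith
  obtain ⟨P, s, hP, hPs⟩ := hM.exists_pairing
  obtain ⟨x, hx⟩ := exists_signs_small_sums (fun v => univ.filter fun w => s(v, w) ∈ H)
    (fun v w h => by simpa [Sym2.eq_swap] using h) (l := 2 * ε * β) hβ1
    (by have := hε.1; positivity)
    (fun v => by simpa only [degV_eq_card_neighbors] using degV_le_of_degE_le hβ0.le hH v)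
    P hP (fun v => boolSign (s v)) (fun v => by cases s v <;> simp [boolSign])
    (by
      convert hnum using 4
      field_simp
      ring)
  let c : V → Bool := fun v => s v == x (P v)
  have hc : ∀ v, boolSign (c v) = boolSign (s v) * boolSign (x (P v)) := fun v => by
    simp only [c]
    cases s v <;> cases x (P v) <;> simp [boolSign]
  let L : Finset V := univ.filter fun v => c v = true
  let R : Finset V := univ.filter fun v => c v = false
  have hcross : ∀ u w, (∃ a ∈ L, ∃ b ∈ R, s(u, w) = s(a, b)) ↔ c u ≠ c w := by
    intro u w
    simp only [L, R, mem_filter, mem_univ, true_and]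
    constructor
    · rintro ⟨a, ha, b, hb, h⟩
      rcases Sym2.eq_iff.1 h with ⟨rfl, rfl⟩ | ⟨rfl, rfl⟩ <;> simp [ha, hb]
    · intro h
      cases hu : c u
      · exact ⟨w, by simpa [hu] using h, u, hu, Sym2.eq_swap⟩
      · exact ⟨u, hu, w, by simpa [hu] using h, rfl⟩
  refine ⟨L, R, ?_, ?_, ?_, ?_⟩
  · ext v; simp [L, R]
  · rw [disjoint_left]; intro v; simp [L, R]
  · intro e he
    induction e with
    | _ u w =>
      obtain ⟨h1, h2⟩ := hPs u w he
      refine (hcross u w).2 ?_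
      simp only [c, h1]
      revert h2
      cases s u <;> cases s w <;> cases x (P w) <;> simp
  · rintro Ehat hEhat Hhat rfl
    have hmem : ∀ u w, s(u, w) ∈ Ehat ↔ s(u, w) ∈ E ∧ c u ≠ c w := fun u w => by
      rw [hEhat, mem_filter, hcross]
    have hdev : ∀ v, |(degV (H ∩ Ehat) v : ℝ) - degV H v / 2| ≤ ε * β := by
      intro v
      rw [abs_degV_bichromatic_sub H (H ∩ Ehat) c (fun u w => by
        rw [mem_inter, hmem]
        exact ⟨fun h => ⟨h.1, h.2.2⟩, fun h => ⟨h.1, hHE h.1, h.2⟩⟩)]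
      simp only [hc]
      linarith [hx v]
    constructor
    · intro e he
      have heH := hH e (mem_inter.1 he).1
      induction e with
      | _ u w =>
        simp only [degE, Sym2.lift_mk, Nat.cast_add] at heH ⊢
        linarith [(abs_le.1 (hdev u)).2, (abs_le.1 (hdev w)).2]
    · intro e he heU
      have heH : e ∉ H := fun h => heU (mem_union_left _ (mem_inter.2 ⟨h, he⟩))
      have hlow : (1 - ε) * β ≤ degE H e := by
        by_contra h
        refine heU (mem_union_right _ ?_)
        rw [hU, mem_filter]
        refine ⟨?_, heH, not_le.1 h⟩
        induction e with
        | _ u w => exact ((hmem u w).1 he).1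
      induction e with
      | _ u w =>
        simp only [degE, Sym2.lift_mk, Nat.cast_add] at hlow ⊢
        linarith [(abs_le.1 (hdev u)).1, (abs_le.1 (hdev w)).1]
end
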